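/- Let d ≥ 1 and n ≥ 1 be integers, K > 0 and 0 < ε ≤ K. Then there exists a constant N depending only on n, d and K such that the following holds. For every n times continuously differentiable map c : ℝᵈ → ℝᵈ satisfying |∂^β c^ρ(x)| ≤ ε for all x ∈ ℝᵈ, all 1 ≤ ρ ≤ d and all multi-indices β with |β| ≤ n, every n times continuously differentiable function u : ℝᵈ → ℝ, every multi-index α with |α| = n, and every x ∈ ℝᵈ: | ∂^α( u ∘ T_c )(x) − (∂^α u)(T_c(x)) − Σ_{ρ=1}^d Σ_{0 ≠ β ≤ α} binom(α,β) ∂^β c^ρ(x) (∂^{α−β} ∂_ρ u)(T_c(x)) | ≤ N ε² Σ_{1 ≤ |ζ| ≤ n} |(∂^ζ u)(T_c(x))|, where T_c(x) := x + c(x). -/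

import Mathlib

open MeasureTheory Finset
open scoped ENNReal

/-- Partial derivative in direction `i`. -/
noncomputable def pd {d : ℕ} (i : Fin d) (f : EuclideanSpace ℝ (Fin d) → ℝ) :
    EuclideanSpace ℝ (Fin d) → ℝ :=
  fun x => fderiv ℝ f x (EuclideanSpace.single i 1)

/-- Multi-index partial derivative `∂^ζ`. -/
noncomputable def mpd {d : ℕ} (ζ : Fin d → ℕ) (f : EuclideanSpace ℝ (Fin d) → ℝ) :
    EuclideanSpace ℝ (Fin d) → ℝ :=
  (List.finRange d).foldr (fun i g => (pd i)^[ζ i] g) f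

/-- Jacobian matrix of a map `ℝᵈ → ℝᵈ`. -/
noncomputable def jac {d : ℕ} (c : EuclideanSpace ℝ (Fin d) → EuclideanSpace ℝ (Fin d))
    (x : EuclideanSpace ℝ (Fin d)) : Matrix (Fin d) (Fin d) ℝ :=
  Matrix.of fun i j => fderiv ℝ (fun y => c y i) x (EuclideanSpace.single j 1)

/-- The finite set of multi-indices `ζ ∈ ℕᵈ` with `|ζ| ≤ n`. -/
def midx (d n : ℕ) : Finset (Fin d → ℕ) :=
  (Finset.univ.image (fun f : Fin d → Fin (n + 1) => fun i => (f i : ℕ))).filter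
    (fun ζ => ∑ i, ζ i ≤ n)

section PartialDerivatives

variable {d : ℕ}

lemma mem_midx {n : ℕ} {ζ : Fin d → ℕ} : ζ ∈ midx d n ↔ ∑ i, ζ i ≤ n := by
  simp only [midx, mem_filter, mem_image, mem_univ, true_and, and_iff_right_iff_imp]
  intro h
  refine ⟨fun i => ⟨ζ i, ?_⟩, rfl⟩
  have := single_le_sum (f := ζ) (fun _ _ => Nat.zero_le _) (mem_univ i)
  omega

lemma sum_add_single (α : Fin d → ℕ) (i : Fin d) :
    ∑ j, (α + Pi.single i 1 : Fin d → ℕ) j = ∑ j, α j + 1 := by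
  simp [sum_add_distrib]

lemma eq_zero_or_exists_add_single (α : Fin d → ℕ) :
    α = 0 ∨ ∃ (β : Fin d → ℕ) (i : Fin d), α = β + Pi.single i 1 := by
  by_cases h : α = 0
  · exact Or.inl h
  · obtain ⟨i, hi⟩ := Function.ne_iff.1 h
    refine Or.inr ⟨α - Pi.single i 1, i, ?_⟩
    ext j
    by_cases hj : j = i
    · subst hj
      simp at hi ⊢
      omega
    · simp [hj]

lemma multiIndex_induction {P : (Fin d → ℕ) → Prop} (zero : P 0)
    (add_single : ∀ (α) (i : Fin d), P α → P (α + Pi.single i 1)) (α : Fin d → ℕ) : P α := by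
  induction h : ∑ j, α j generalizing α with
  | zero =>
    have : α = 0 := by
      ext j
      exact (sum_eq_zero_iff.1 h) j (mem_univ j)
    exact this ▸ zero
  | succ k ih =>
    obtain rfl | ⟨β, i, rfl⟩ := eq_zero_or_exists_add_single α
    · exact zero
    · rw [sum_add_single] at h
      exact add_single _ _ (ih β (by omega))

lemma sum_sub_le (α β : Fin d → ℕ) : ∑ i, (α - β) i ≤ ∑ i, α i :=
  sum_le_sum fun _ _ => Nat.sub_le _ _

/-- The binomial convolution `∑_{β ≤ α} binom(α, β) A(β, α - β)`. -/
noncomputable def binomSum (α : Fin d → ℕ) (A : (Fin d → ℕ) → (Fin d → ℕ) → ℝ) : ℝ :=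
  ∑ β ∈ Iic α, (∏ i, ((α i).choose (β i) : ℝ)) * A β (α - β)

lemma binomSum_eq_of_subset {α : Fin d → ℕ} {A : (Fin d → ℕ) → (Fin d → ℕ) → ℝ}
    {s : Finset (Fin d → ℕ)} (hs : Iic α ⊆ s) :
    binomSum α A = ∑ β ∈ s, (∏ i, ((α i).choose (β i) : ℝ)) * A β (α - β) := by
  refine sum_subset hs fun β _ hβ => ?_
  simp only [mem_Iic, Pi.le_def, not_forall, not_le] at hβ
  obtain ⟨i, hi⟩ := hβ
  rw [prod_eq_zero (mem_univ i) (by simp [Nat.choose_eq_zero_of_lt hi]), zero_mul]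

/-- Pascal's rule for multi-indices. -/
lemma prod_choose_add_single (α β : Fin d → ℕ) (i : Fin d) :
    ∏ j, (((α + Pi.single i 1 : Fin d → ℕ) j).choose ((β + Pi.single i 1 : Fin d → ℕ) j) : ℝ) =
      ∏ j, ((α j).choose (β j) : ℝ) + ∏ j, ((α j).choose ((β + Pi.single i 1 : Fin d → ℕ) j) : ℝ) := by
  simp only [← mul_prod_erase univ _ (mem_univ i)]
  have h : ∀ γ δ : Fin d → ℕ, ∏ j ∈ univ.erase i, (((γ + Pi.single i 1 : Fin d → ℕ) j).choose (δ j) : ℝ) =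
      ∏ j ∈ univ.erase i, ((γ j).choose (δ j) : ℝ) := fun γ δ =>
    prod_congr rfl fun j hj => by simp [(mem_erase.1 hj).1]
  have h' : ∏ j ∈ univ.erase i, ((α j).choose ((β + Pi.single i 1 : Fin d → ℕ) j) : ℝ) =
      ∏ j ∈ univ.erase i, ((α j).choose (β j) : ℝ) :=
    prod_congr rfl fun j hj => by simp [(mem_erase.1 hj).1]
  rw [h, h']
  simp [Nat.choose_succ_succ, add_mul]

lemma prod_choose_add_single_of_eq_zero (α β : Fin d → ℕ) (i : Fin d) (hβ : β i = 0) :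
    ∏ j, (((α + Pi.single i 1 : Fin d → ℕ) j).choose (β j) : ℝ) = ∏ j, ((α j).choose (β j) : ℝ) :=
  prod_congr rfl fun j _ => by
    by_cases hj : j = i
    · subst hj; simp [hβ]
    · simp [hj]

lemma binomSum_add_single (α : Fin d → ℕ) (i : Fin d)
    (A : (Fin d → ℕ) → (Fin d → ℕ) → ℝ) :
    binomSum (α + Pi.single i 1) A =
      binomSum α (fun β γ => A (β + Pi.single i 1) γ) +
        binomSum α (fun β γ => A β (γ + Pi.single i 1)) := by
  have key : ∀ F : (Fin d → ℕ) → ℝ, ∑ β ∈ Iic (α + Pi.single i 1), F β =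
      ∑ β ∈ Iic (α + Pi.single i 1) with β i = 0, F β + ∑ β ∈ Iic α, F (β + Pi.single i 1) := by
    intro F
    rw [← sum_filter_add_sum_filter_not _ (fun β => β i = 0)]
    congr 1
    symm
    refine sum_nbij' (fun β => β + Pi.single i 1) (fun β => β - Pi.single i 1) ?_ ?_ ?_ ?_ ?_
    · intro β hβ
      simpa using hβ
    · intro β hβ
      simp only [mem_filter, mem_Iic] at hβ ⊢
      exact tsub_le_iff_right.2 hβ.1
    · intro β _
      simp
    · intro β hβ
      simp only [mem_filter, mem_Iic] at hβ
      refine tsub_add_cancel_of_le fun j => ?_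
      by_cases hj : j = i
      · subst hj
        simpa using Nat.one_le_iff_ne_zero.2 hβ.2
      · simp [hj]
    · intro β _
      rfl
  have hle : α ≤ α + Pi.single i 1 := le_self_add
  rw [binomSum_eq_of_subset (α := α) (Iic_subset_Iic.2 hle) (A := fun β γ => A β _), key]
  rw [binomSum, key, binomSum]
  have e1 : ∀ β : Fin d → ℕ, α + Pi.single i 1 - (β + Pi.single i 1) = α - β := fun β =>
    add_tsub_add_eq_tsub_right _ _ _
  have e2 : ∀ β ∈ {β ∈ Iic (α + Pi.single i 1) | β i = 0},
      (∏ j, (((α + Pi.single i 1 : Fin d → ℕ) j).choose (β j) : ℝ)) * A β (α + Pi.single i 1 - β) =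
      (∏ j, ((α j).choose (β j) : ℝ)) * A β (α - β + Pi.single i 1) := by
    intro β hβ
    simp only [mem_filter, mem_Iic] at hβ
    rw [prod_choose_add_single_of_eq_zero α β i hβ.2, tsub_add_eq_add_tsub]
    intro j
    have := hβ.1 j
    by_cases hj : j = i
    · subst hj; simp [hβ.2]
    · simpa [hj] using this
  have e3 : ∀ β : Fin d → ℕ,
      (∏ j, ((α j).choose ((β + Pi.single i 1 : Fin d → ℕ) j) : ℝ)) *
        A (β + Pi.single i 1) (α - (β + Pi.single i 1) + Pi.single i 1) =
      (∏ j, ((α j).choose ((β + Pi.single i 1 : Fin d → ℕ) j) : ℝ)) * A (β + Pi.single i 1) (α - β) := by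
    intro β
    by_cases h : β + Pi.single i 1 ≤ α
    · congr 2
      ext j
      have := h j
      by_cases hj : j = i
      · subst hj; simp at this ⊢; omega
      · simp [hj]
    · simp only [Pi.le_def, not_forall, not_le] at h
      obtain ⟨j, hj⟩ := h
      rw [prod_eq_zero (mem_univ j) (by simp only [Nat.choose_eq_zero_of_lt hj, Nat.cast_zero]),
        zero_mul, zero_mul]
  rw [sum_congr rfl e2]
  simp only [e1, e3, prod_choose_add_single, add_mul, sum_add_distrib]
  ring

lemma binomSum_zero (A : (Fin d → ℕ) → (Fin d → ℕ) → ℝ) : binomSum 0 A = A 0 0 := by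
  have : Iic (0 : Fin d → ℕ) = {0} := by ext; simp
  simp [binomSum, this]

lemma binomSum_one (α : Fin d → ℕ) : binomSum α (fun _ _ => 1) = 2 ^ ∑ i, α i := by
  induction α using multiIndex_induction with
  | zero => simp [binomSum_zero]
  | add_single α i ih => rw [binomSum_add_single, ih, sum_add_single]; ring

lemma binomSum_congr {α : Fin d → ℕ} {A B : (Fin d → ℕ) → (Fin d → ℕ) → ℝ}
    (h : ∀ β ≤ α, A β (α - β) = B β (α - β)) : binomSum α A = binomSum α B :=
  sum_congr rfl fun β hβ => by rw [h β (mem_Iic.1 hβ)]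

lemma binomSum_sub (α : Fin d → ℕ) (A B : (Fin d → ℕ) → (Fin d → ℕ) → ℝ) :
    binomSum α A - binomSum α B = binomSum α (fun β γ => A β γ - B β γ) := by
  simp only [binomSum, mul_sub, sum_sub_distrib]

lemma abs_binomSum_le {α : Fin d → ℕ} {m : ℕ} (hα : ∑ i, α i ≤ m)
    {A : (Fin d → ℕ) → (Fin d → ℕ) → ℝ} {C : ℝ}
    (h : ∀ β ≤ α, |A β (α - β)| ≤ C) : |binomSum α A| ≤ 2 ^ m * C := by
  have hC : 0 ≤ C := (abs_nonneg _).trans (h α le_rfl)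
  calc |binomSum α A| ≤ ∑ β ∈ Iic α, (∏ i, ((α i).choose (β i) : ℝ)) * C := by
        refine (abs_sum_le_sum_abs _ _).trans (sum_le_sum fun β hβ => ?_)
        rw [abs_mul, abs_of_nonneg (prod_nonneg fun _ _ => Nat.cast_nonneg _)]
        exact mul_le_mul_of_nonneg_left (h β (mem_Iic.1 hβ))
          (prod_nonneg fun _ _ => Nat.cast_nonneg _)
    _ = 2 ^ (∑ i, α i) * C := by
        rw [← binomSum_one, binomSum, sum_mul]
        simp
    _ ≤ 2 ^ m * C := by gcongr; norm_num

end PartialDerivatives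

section MultiDeriv

variable {d : ℕ}

lemma contDiff_pd {k : ℕ} {f : EuclideanSpace ℝ (Fin d) → ℝ} (i : Fin d)
    (hf : ContDiff ℝ ((k + 1 : ℕ) : ℕ∞) f) : ContDiff ℝ (k : ℕ∞) (pd i f) :=
  (hf.fderiv_right (m := ((k : ℕ∞) : WithTop ℕ∞)) (by norm_cast)).clm_apply contDiff_const

lemma pd_comm {f : EuclideanSpace ℝ (Fin d) → ℝ} (i j : Fin d)
    (hf : ContDiff ℝ ((2 : ℕ) : ℕ∞) f) : pd i (pd j f) = pd j (pd i f) := by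
  have hd : Differentiable ℝ (fderiv ℝ f) :=
    (hf.fderiv_right (m := 1) (by norm_cast)).differentiable (by norm_num)
  have h : ∀ (a b : Fin d) (x), pd a (pd b f) x =
      fderiv ℝ (fderiv ℝ f) x (EuclideanSpace.single a 1) (EuclideanSpace.single b 1) := by
    intro a b x
    unfold pd
    rw [fderiv_clm_apply (hd x) (differentiableAt_const _)]
    simp
  ext x
  rw [h, h]
  exact (hf.contDiffAt.isSymmSndFDerivAt (by simp)) _ _

lemma contDiff_iterate_pd {k m : ℕ} {f : EuclideanSpace ℝ (Fin d) → ℝ} (i : Fin d)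
    (hf : ContDiff ℝ ((k + m : ℕ) : ℕ∞) f) : ContDiff ℝ (k : ℕ∞) ((pd i)^[m] f) := by
  induction m generalizing f with
  | zero => exact hf
  | succ m ih => exact ih (contDiff_pd i hf)

lemma iterate_pd_comm {m : ℕ} {f : EuclideanSpace ℝ (Fin d) → ℝ} (i j : Fin d)
    (hf : ContDiff ℝ ((m + 1 : ℕ) : ℕ∞) f) : (pd i)^[m] (pd j f) = pd j ((pd i)^[m] f) := by
  induction m generalizing f with
  | zero => rfl
  | succ m ih =>
    rw [Function.iterate_succ_apply, Function.iterate_succ_apply, ← ih (contDiff_pd i hf),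
      pd_comm i j (hf.of_le (by norm_cast; omega))]

lemma contDiff_foldr_pd (l : List (Fin d)) (ζ : Fin d → ℕ) {k : ℕ}
    {f : EuclideanSpace ℝ (Fin d) → ℝ} (hf : ContDiff ℝ ((k + (l.map ζ).sum : ℕ) : ℕ∞) f) :
    ContDiff ℝ (k : ℕ∞) (l.foldr (fun i g => (pd i)^[ζ i] g) f) := by
  induction l generalizing k with
  | nil => simpa using hf
  | cons j l ih =>
    refine contDiff_iterate_pd j (ih ?_)
    rwa [List.map_cons, List.sum_cons, ← add_assoc] at hf

lemma foldr_pd_comm (l : List (Fin d)) (ζ : Fin d → ℕ) (i : Fin d)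
    {f : EuclideanSpace ℝ (Fin d) → ℝ} (hf : ContDiff ℝ ((1 + (l.map ζ).sum : ℕ) : ℕ∞) f) :
    l.foldr (fun i g => (pd i)^[ζ i] g) (pd i f) =
      pd i (l.foldr (fun i g => (pd i)^[ζ i] g) f) := by
  induction l with
  | nil => rfl
  | cons j l ih =>
    rw [List.map_cons, List.sum_cons] at hf
    rw [List.foldr_cons, List.foldr_cons, ih (hf.of_le (by norm_cast; omega)),
      iterate_pd_comm]
    exact contDiff_foldr_pd l ζ (hf.of_le (by norm_cast; omega))

lemma foldr_pd_add_single (l : List (Fin d)) (hl : l.Nodup) (ζ : Fin d → ℕ) (i : Fin d)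
    {f : EuclideanSpace ℝ (Fin d) → ℝ} (hf : ContDiff ℝ ((1 + (l.map ζ).sum : ℕ) : ℕ∞) f) :
    l.foldr (fun j g => (pd j)^[(ζ + Pi.single i 1 : Fin d → ℕ) j] g) f =
      if i ∈ l then l.foldr (fun j g => (pd j)^[ζ j] g) (pd i f)
      else l.foldr (fun j g => (pd j)^[ζ j] g) f := by
  induction l with
  | nil => simp
  | cons j l ih =>
    rw [List.map_cons, List.sum_cons] at hf
    have hf' : ContDiff ℝ ((1 + (l.map ζ).sum : ℕ) : ℕ∞) f := hf.of_le (by norm_cast; omega)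
    rw [List.nodup_cons] at hl
    rw [List.foldr_cons, ih hl.2 hf']
    by_cases hij : j = i
    · subst hij
      simp [hl.1, foldr_pd_comm l ζ j hf', Function.iterate_succ_apply]
    · simp only [List.mem_cons, Ne.symm hij, false_or, Pi.add_apply, List.foldr_cons,
        Pi.single_eq_of_ne hij, add_zero]
      split_ifs <;> rfl

lemma sum_map_finRange (ζ : Fin d → ℕ) : ((List.finRange d).map ζ).sum = ∑ i, ζ i := by
  rw [← List.ofFn_eq_map, List.sum_ofFn]

lemma mpd_zero (f : EuclideanSpace ℝ (Fin d) → ℝ) : mpd 0 f = f := by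
  unfold mpd
  induction List.finRange d with
  | nil => rfl
  | cons j l ih => simp

lemma mpd_add_single {α : Fin d → ℕ} (i : Fin d) {f : EuclideanSpace ℝ (Fin d) → ℝ} {k : ℕ}
    (hα : ∑ j, α j + 1 ≤ k) (hf : ContDiff ℝ (k : ℕ∞) f) :
    mpd (α + Pi.single i 1) f = mpd α (pd i f) := by
  have := foldr_pd_add_single (List.finRange d) (List.nodup_finRange d) α i (f := f)
    (hf.of_le (by rw [sum_map_finRange]; norm_cast; omega))
  rwa [if_pos (List.mem_finRange i)] at this

lemma pd_add {f g : EuclideanSpace ℝ (Fin d) → ℝ} (i : Fin d) (hf : ContDiff ℝ ((1 : ℕ) : ℕ∞) f)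
    (hg : ContDiff ℝ ((1 : ℕ) : ℕ∞) g) :
    pd i (fun x => f x + g x) = fun x => pd i f x + pd i g x := by
  ext x
  unfold pd
  rw [fderiv_fun_add (hf.differentiable (by simp) x) (hg.differentiable (by simp) x)]
  rfl

lemma pd_mul {f g : EuclideanSpace ℝ (Fin d) → ℝ} (i : Fin d) (hf : ContDiff ℝ ((1 : ℕ) : ℕ∞) f)
    (hg : ContDiff ℝ ((1 : ℕ) : ℕ∞) g) :
    pd i (fun x => f x * g x) = fun x => pd i f x * g x + f x * pd i g x := by
  ext x
  unfold pd
  rw [fderiv_fun_mul (hf.differentiable (by simp) x) (hg.differentiable (by simp) x)]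
  simp
  ring

lemma mpd_add {α : Fin d → ℕ} {f g : EuclideanSpace ℝ (Fin d) → ℝ} {k : ℕ}
    (hα : ∑ j, α j ≤ k) (hf : ContDiff ℝ (k : ℕ∞) f) (hg : ContDiff ℝ (k : ℕ∞) g) :
    mpd α (fun x => f x + g x) = fun x => mpd α f x + mpd α g x := by
  induction α using multiIndex_induction generalizing f g k with
  | zero => simp [mpd_zero]
  | add_single α i ih =>
    rw [sum_add_single] at hα
    obtain ⟨k, rfl⟩ : ∃ l, k = l + 1 := ⟨k - 1, by omega⟩
    rw [mpd_add_single i hα hf, mpd_add_single i hα hg, mpd_add_single i hα (hf.add hg),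
      pd_add i (hf.of_le (by norm_cast; omega)) (hg.of_le (by norm_cast; omega))]
    exact ih (by omega) (contDiff_pd i hf) (contDiff_pd i hg)

lemma mpd_sum {ι : Type*} (s : Finset ι) {α : Fin d → ℕ}
    {f : ι → EuclideanSpace ℝ (Fin d) → ℝ} {k : ℕ}
    (hα : ∑ j, α j ≤ k) (hf : ∀ a, ContDiff ℝ (k : ℕ∞) (f a)) :
    mpd α (fun x => ∑ a ∈ s, f a x) = fun x => ∑ a ∈ s, mpd α (f a) x := by
  classical
  induction s using Finset.induction_on with
  | empty =>
    have h := mpd_add (α := α) (f := fun _ : EuclideanSpace ℝ (Fin d) => (0 : ℝ))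
      (g := fun _ => 0) hα contDiff_const contDiff_const
    ext x
    simpa using congrFun h x
  | insert a s ha ih =>
    simp only [sum_insert ha]
    rw [mpd_add hα (hf a) (ContDiff.sum fun a _ => hf a), ih]

/-- The Leibniz rule for multi-index derivatives. -/
lemma mpd_mul {α : Fin d → ℕ} {f g : EuclideanSpace ℝ (Fin d) → ℝ} {k : ℕ}
    (hα : ∑ j, α j ≤ k) (hf : ContDiff ℝ (k : ℕ∞) f) (hg : ContDiff ℝ (k : ℕ∞) g)
    (x : EuclideanSpace ℝ (Fin d)) :
    mpd α (fun x => f x * g x) x = binomSum α (fun β γ => mpd β f x * mpd γ g x) := by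
  induction α using multiIndex_induction generalizing f g k with
  | zero => simp [mpd_zero, binomSum_zero]
  | add_single α i ih =>
    rw [sum_add_single] at hα
    obtain ⟨k, rfl⟩ : ∃ l, k = l + 1 := ⟨k - 1, by omega⟩
    have hf' := hf.of_le (m := ((k : ℕ∞) : WithTop ℕ∞)) (by norm_cast; omega)
    have hg' := hg.of_le (m := ((k : ℕ∞) : WithTop ℕ∞)) (by norm_cast; omega)
    have hα' : ∑ j, α j ≤ k := by omega
    rw [mpd_add_single i hα (hf.mul hg),
      pd_mul i (hf.of_le (by norm_cast; omega)) (hg.of_le (by norm_cast; omega)),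
      mpd_add hα' ((contDiff_pd i hf).mul hg') (hf'.mul (contDiff_pd i hg)),
      binomSum_add_single]
    dsimp only
    rw [ih hα' (contDiff_pd i hf) hg', ih hα' hf' (contDiff_pd i hg)]
    congr 1
    · refine binomSum_congr fun β hβ => ?_
      rw [mpd_add_single i _ hf]
      have : ∑ j, β j ≤ ∑ j, α j := sum_le_sum fun j _ => hβ j
      omega
    · refine binomSum_congr fun β hβ => ?_
      rw [mpd_add_single i _ hg]
      have := sum_sub_le α β
      omega

lemma contDiff_component {k : ℕ} {c : EuclideanSpace ℝ (Fin d) → EuclideanSpace ℝ (Fin d)}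
    (hc : ContDiff ℝ (k : ℕ∞) c) (ρ : Fin d) : ContDiff ℝ (k : ℕ∞) (fun y => c y ρ) :=
  (contDiff_euclidean.1 hc) ρ

lemma pd_comp_id_add {u : EuclideanSpace ℝ (Fin d) → ℝ}
    {c : EuclideanSpace ℝ (Fin d) → EuclideanSpace ℝ (Fin d)} (i : Fin d)
    (hu : ContDiff ℝ ((1 : ℕ) : ℕ∞) u) (hc : ContDiff ℝ ((1 : ℕ) : ℕ∞) c) :
    pd i (fun y => u (y + c y)) = fun x => pd i u (x + c x) +
      ∑ ρ, pd i (fun y => c y ρ) x * pd ρ u (x + c x) := by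
  ext x
  have hcd : DifferentiableAt ℝ c x := hc.differentiable (by simp) x
  have hud : DifferentiableAt ℝ u (x + c x) := hu.differentiable (by simp) _
  have h1 : HasFDerivAt (fun y => u (y + c y))
      ((fderiv ℝ u (x + c x)).comp (ContinuousLinearMap.id ℝ _ + fderiv ℝ c x)) x :=
    hud.hasFDerivAt.comp x ((hasFDerivAt_id x).add hcd.hasFDerivAt)
  have h2 : ∀ ρ, pd i (fun y => c y ρ) x = fderiv ℝ c x (EuclideanSpace.single i 1) ρ := by
    intro ρ
    have := ((EuclideanSpace.proj (𝕜 := ℝ) ρ).hasFDerivAt (x := c x)).comp x hcd.hasFDerivAt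
    unfold pd
    exact congrArg (fun L => L (EuclideanSpace.single i 1)) this.fderiv
  have h3 : ∀ v : EuclideanSpace ℝ (Fin d), fderiv ℝ u (x + c x) v =
      ∑ ρ, v ρ * pd ρ u (x + c x) := by
    intro v
    conv_lhs => rw [← (EuclideanSpace.basisFun (Fin d) ℝ).sum_repr v]
    simp [pd]
  rw [pd, h1.fderiv]
  simp only [h2, ← h3]
  simp [pd]

end MultiDeriv

section SmallPerturbation

variable {d : ℕ}

/-- The derivatives of order at most `n` of every component of the `C^n` map `c` are bounded
by `ε`. -/
def IsSmallPerturbation (n : ℕ) (ε : ℝ)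
    (c : EuclideanSpace ℝ (Fin d) → EuclideanSpace ℝ (Fin d)) : Prop :=
  ContDiff ℝ (n : ℕ∞) c ∧ ∀ β : Fin d → ℕ, ∑ i, β i ≤ n →
    ∀ (ρ : Fin d) (x : EuclideanSpace ℝ (Fin d)), |mpd β (fun y => c y ρ) x| ≤ ε

/-- The sum `∑_{1 ≤ |ζ| ≤ n} |∂^ζ u(y)|`. -/
noncomputable def derivSum (n : ℕ) (u : EuclideanSpace ℝ (Fin d) → ℝ)
    (y : EuclideanSpace ℝ (Fin d)) : ℝ :=
  ∑ ζ ∈ (midx d n).filter (fun ζ => 1 ≤ ∑ i, ζ i), |mpd ζ u y|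

lemma derivSum_nonneg (n : ℕ) (u : EuclideanSpace ℝ (Fin d) → ℝ)
    (y : EuclideanSpace ℝ (Fin d)) : 0 ≤ derivSum n u y :=
  sum_nonneg fun _ _ => abs_nonneg _

lemma abs_mpd_pd_le_derivSum {m : ℕ} {u : EuclideanSpace ℝ (Fin d) → ℝ}
    (hu : ContDiff ℝ ((m + 1 : ℕ) : ℕ∞) u) (i : Fin d) {ζ : Fin d → ℕ} (hζ : ∑ j, ζ j ≤ m)
    (y : EuclideanSpace ℝ (Fin d)) : |mpd ζ (pd i u) y| ≤ derivSum (m + 1) u y := by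
  rw [← mpd_add_single i (by omega) hu]
  refine single_le_sum (f := fun ζ => |mpd ζ u y|) (fun _ _ => abs_nonneg _) ?_
  rw [mem_filter, mem_midx, sum_add_single]
  omega

lemma derivSum_pd_le {m : ℕ} {u : EuclideanSpace ℝ (Fin d) → ℝ}
    (hu : ContDiff ℝ ((m + 1 : ℕ) : ℕ∞) u) (i : Fin d) (y : EuclideanSpace ℝ (Fin d)) :
    derivSum m (pd i u) y ≤ derivSum (m + 1) u y := by
  unfold derivSum
  have hinj : Function.Injective (fun ζ : Fin d → ℕ => ζ + Pi.single i 1) :=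
    add_left_injective _
  calc ∑ ζ ∈ midx d m with 1 ≤ ∑ i, ζ i, |mpd ζ (pd i u) y|
      = ∑ ζ ∈ (midx d m).filter (fun ζ => 1 ≤ ∑ i, ζ i), |mpd (ζ + Pi.single i 1) u y| := by
        refine sum_congr rfl fun ζ hζ => ?_
        rw [mem_filter, mem_midx] at hζ
        rw [mpd_add_single i (by omega) hu]
    _ = ∑ ζ ∈ ((midx d m).filter (fun ζ => 1 ≤ ∑ i, ζ i)).image (fun ζ => ζ + Pi.single i 1),
          |mpd ζ u y| :=
          (sum_image (f := fun ζ => |mpd ζ u y|) hinj.injOn).symm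
    _ ≤ _ := by
        refine sum_le_sum_of_subset_of_nonneg (fun ζ hζ => ?_) fun _ _ _ => abs_nonneg _
        obtain ⟨ξ, hξ, rfl⟩ := mem_image.1 hζ
        rw [mem_filter, mem_midx] at hξ ⊢
        rw [sum_add_single]
        omega

lemma contDiff_comp_id_add {k : ℕ} {u : EuclideanSpace ℝ (Fin d) → ℝ}
    {c : EuclideanSpace ℝ (Fin d) → EuclideanSpace ℝ (Fin d)}
    (hu : ContDiff ℝ (k : ℕ∞) u) (hc : ContDiff ℝ (k : ℕ∞) c) :
    ContDiff ℝ (k : ℕ∞) (fun y => u (y + c y)) :=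
  hu.comp (contDiff_id.add hc)

lemma mpd_add_single_comp_id_add {m : ℕ} {u : EuclideanSpace ℝ (Fin d) → ℝ}
    {c : EuclideanSpace ℝ (Fin d) → EuclideanSpace ℝ (Fin d)}
    (hu : ContDiff ℝ ((m + 1 : ℕ) : ℕ∞) u) (hc : ContDiff ℝ ((m + 1 : ℕ) : ℕ∞) c)
    {α : Fin d → ℕ} (hα : ∑ j, α j ≤ m) (i : Fin d) (x : EuclideanSpace ℝ (Fin d)) :
    mpd (α + Pi.single i 1) (fun y => u (y + c y)) x =
      mpd α (fun y => pd i u (y + c y)) x +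
        ∑ ρ, binomSum α (fun β γ => mpd (β + Pi.single i 1) (fun y => c y ρ) x *
          mpd γ (fun y => pd ρ u (y + c y)) x) := by
  have hc' : ContDiff ℝ (m : ℕ∞) c := hc.of_le (by norm_cast; omega)
  have h1 : ∀ ρ, ContDiff ℝ (m : ℕ∞) (pd i (fun y => c y ρ)) := fun ρ =>
    contDiff_pd i (contDiff_component hc ρ)
  have h2 : ∀ ρ, ContDiff ℝ (m : ℕ∞) (fun y => pd ρ u (y + c y)) := fun ρ =>
    contDiff_comp_id_add (contDiff_pd ρ hu) hc'
  rw [mpd_add_single i (by omega) (contDiff_comp_id_add hu hc),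
    pd_comp_id_add i (hu.of_le (by norm_cast; omega)) (hc.of_le (by norm_cast; omega)),
    mpd_add hα (h2 i) (ContDiff.sum fun ρ _ => (h1 ρ).mul (h2 ρ)),
    mpd_sum univ hα (fun ρ => (h1 ρ).mul (h2 ρ))]
  refine congrArg _ (sum_congr rfl fun ρ _ => ?_)
  rw [mpd_mul hα (h1 ρ) (h2 ρ)]
  refine binomSum_congr fun β hβ => ?_
  have : ∑ j, β j ≤ ∑ j, α j := sum_le_sum fun j _ => hβ j
  rw [mpd_add_single i (by omega) (contDiff_component hc ρ)]

lemma abs_sum_binomSum_le {α : Fin d → ℕ} {m : ℕ} (hα : ∑ i, α i ≤ m)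
    {A : Fin d → (Fin d → ℕ) → (Fin d → ℕ) → ℝ} {C : ℝ}
    (h : ∀ ρ, ∀ β ≤ α, |A ρ β (α - β)| ≤ C) : |∑ ρ, binomSum α (A ρ)| ≤ d * (2 ^ m * C) := by
  refine (abs_sum_le_sum_abs _ _).trans ?_
  simpa using sum_le_card_nsmul univ (fun ρ => |binomSum α (A ρ)|) _
    fun ρ _ => abs_binomSum_le hα (h ρ)

/-- The part of `∂^α(u ∘ T_c)` that is linear in the derivatives of `c`. -/
noncomputable def linearPart (c : EuclideanSpace ℝ (Fin d) → EuclideanSpace ℝ (Fin d))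
    (u : EuclideanSpace ℝ (Fin d) → ℝ) (α : Fin d → ℕ) (x : EuclideanSpace ℝ (Fin d)) : ℝ :=
  ∑ ρ, binomSum α (fun β γ =>
    (if β = 0 then 0 else mpd β (fun y => c y ρ) x) * mpd γ (pd ρ u) (x + c x))

lemma linearPart_add_single {m : ℕ} {u : EuclideanSpace ℝ (Fin d) → ℝ}
    (c : EuclideanSpace ℝ (Fin d) → EuclideanSpace ℝ (Fin d))
    (hu : ContDiff ℝ ((m + 1 : ℕ) : ℕ∞) u) {α : Fin d → ℕ} (hα : ∑ j, α j ≤ m) (i : Fin d)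
    (x : EuclideanSpace ℝ (Fin d)) :
    linearPart c u (α + Pi.single i 1) x =
      (∑ ρ, binomSum α (fun β γ => mpd (β + Pi.single i 1) (fun y => c y ρ) x *
        mpd γ (pd ρ u) (x + c x))) + linearPart c (pd i u) α x := by
  have hne : ∀ β : Fin d → ℕ, β + Pi.single i 1 ≠ 0 := fun β h => by
    simpa using congrFun h i
  unfold linearPart
  rw [← sum_add_distrib]
  refine sum_congr rfl fun ρ _ => ?_
  rw [binomSum_add_single]
  simp only [hne, if_false]
  congr 1
  refine binomSum_congr fun β hβ => ?_
  by_cases h0 : β = 0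
  · simp [h0]
  · obtain rfl | ⟨β, j, rfl⟩ := eq_zero_or_exists_add_single β
    · exact absurd rfl h0
    have hlt : ∑ l, (α - (β + Pi.single j 1) : Fin d → ℕ) l + ∑ l, (β + Pi.single j 1 : Fin d → ℕ) l =
        ∑ j, α j := by
      rw [← sum_add_distrib]
      exact sum_congr rfl fun l _ => Nat.sub_add_cancel (hβ l)
    rw [sum_add_single] at hlt
    obtain ⟨m, rfl⟩ : ∃ k, m = k + 1 := ⟨m - 1, by omega⟩
    rw [mpd_add_single i (by omega) (contDiff_pd ρ hu),
      pd_comm i ρ (hu.of_le (by norm_cast; omega))]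

lemma exists_abs_mpd_comp_sub_le (d m : ℕ) {K : ℝ} (hK : 0 ≤ K) :
    ∃ N : ℝ, 0 ≤ N ∧ ∀ n, m ≤ n → ∀ ε, 0 ≤ ε → ε ≤ K →
      ∀ c : EuclideanSpace ℝ (Fin d) → EuclideanSpace ℝ (Fin d), IsSmallPerturbation n ε c →
        ∀ u : EuclideanSpace ℝ (Fin d) → ℝ, ContDiff ℝ (m : ℕ∞) u →
          ∀ α : Fin d → ℕ, ∑ i, α i ≤ m → ∀ x : EuclideanSpace ℝ (Fin d),
            |mpd α (fun y => u (y + c y)) x - mpd α u (x + c x)| ≤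
              N * ε * derivSum m u (x + c x) := by
  induction m with
  | zero =>
    refine ⟨0, le_rfl, fun n _ ε _ _ c _ u _ α hα x => ?_⟩
    obtain rfl | ⟨β, i, rfl⟩ := eq_zero_or_exists_add_single α
    · simp [mpd_zero]
    · rw [sum_add_single] at hα
      omega
  | succ m ih =>
    obtain ⟨N, hN, ih⟩ := ih
    refine ⟨N + d * (2 ^ m * (1 + N * K)), by positivity,
      fun n hmn ε hε hεK c hc u hu α hα x => ?_⟩
    have hS := derivSum_nonneg (m + 1) u (x + c x)
    obtain rfl | ⟨α, i, rfl⟩ := eq_zero_or_exists_add_single α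
    · simp only [mpd_zero, sub_self, abs_zero]
      positivity
    rw [sum_add_single] at hα
    have hα' : ∑ j, α j ≤ m := by omega
    have hcm : ContDiff ℝ ((m + 1 : ℕ) : ℕ∞) c := hc.1.of_le (by exact_mod_cast hmn)
    have hpd := fun ρ {γ} (hγ : ∑ j, γ j ≤ m) =>
      (ih n (by omega) ε hε hεK c hc (pd ρ u) (contDiff_pd ρ hu) γ hγ x).trans
        (mul_le_mul_of_nonneg_left (derivSum_pd_le hu ρ (x + c x)) (by positivity))
    rw [mpd_add_single_comp_id_add hu hcm hα', mpd_add_single i (by omega) hu, add_sub_right_comm]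
    calc _ ≤ N * ε * derivSum (m + 1) u (x + c x) +
          d * (2 ^ m * (ε * ((1 + N * K) * derivSum (m + 1) u (x + c x)))) := by
          refine (abs_add_le _ _).trans (add_le_add (hpd i hα') (abs_sum_binomSum_le hα' ?_))
          intro ρ β hβ
          have hβm : ∑ j, β j ≤ ∑ j, α j := sum_le_sum fun j _ => hβ j
          have hγ : ∑ j, (α - β) j ≤ m := (sum_sub_le α β).trans hα'
          rw [abs_mul]
          refine mul_le_mul (hc.2 _ (by rw [sum_add_single]; omega) ρ x) ?_ (abs_nonneg _) hε
          have h1 := hpd ρ hγ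
          have h2 := abs_mpd_pd_le_derivSum hu ρ hγ (x + c x)
          have h3 : N * ε * derivSum (m + 1) u (x + c x) ≤
              N * K * derivSum (m + 1) u (x + c x) := by gcongr
          have h4 := abs_sub_abs_le_abs_sub (mpd (α - β) (fun y => pd ρ u (y + c y)) x)
            (mpd (α - β) (pd ρ u) (x + c x))
          linarith
      _ = _ := by ring

lemma exists_abs_mpd_comp_sub_linearPart_le (d m : ℕ) {K : ℝ} (hK : 0 ≤ K) :
    ∃ N : ℝ, 0 ≤ N ∧ ∀ n, m ≤ n → ∀ ε, 0 ≤ ε → ε ≤ K →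
      ∀ c : EuclideanSpace ℝ (Fin d) → EuclideanSpace ℝ (Fin d), IsSmallPerturbation n ε c →
        ∀ u : EuclideanSpace ℝ (Fin d) → ℝ, ContDiff ℝ (m : ℕ∞) u →
          ∀ α : Fin d → ℕ, ∑ i, α i ≤ m → ∀ x : EuclideanSpace ℝ (Fin d),
            |mpd α (fun y => u (y + c y)) x - mpd α u (x + c x) - linearPart c u α x| ≤
              N * ε ^ 2 * derivSum m u (x + c x) := by
  have zero : ∀ (c : EuclideanSpace ℝ (Fin d) → EuclideanSpace ℝ (Fin d))
      (u : EuclideanSpace ℝ (Fin d) → ℝ) (x : EuclideanSpace ℝ (Fin d)),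
      mpd 0 (fun y => u (y + c y)) x - mpd 0 u (x + c x) - linearPart c u 0 x = 0 := by
    intro c u x
    simp [mpd_zero, linearPart, binomSum_zero]
  induction m with
  | zero =>
    refine ⟨0, le_rfl, fun n _ ε _ _ c _ u _ α hα x => ?_⟩
    obtain rfl | ⟨β, i, rfl⟩ := eq_zero_or_exists_add_single α
    · simp [zero]
    · rw [sum_add_single] at hα
      omega
  | succ m ih =>
    obtain ⟨N, hN, ih⟩ := ih
    obtain ⟨M, hM, hfirst⟩ := exists_abs_mpd_comp_sub_le d m hK
    refine ⟨N + d * (2 ^ m * M), by positivity, fun n hmn ε hε hεK c hc u hu α hα x => ?_⟩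
    have hS := derivSum_nonneg (m + 1) u (x + c x)
    obtain rfl | ⟨α, i, rfl⟩ := eq_zero_or_exists_add_single α
    · rw [zero, abs_zero]
      positivity
    rw [sum_add_single] at hα
    have hα' : ∑ j, α j ≤ m := by omega
    have hcm : ContDiff ℝ ((m + 1 : ℕ) : ℕ∞) c := hc.1.of_le (by exact_mod_cast hmn)
    have hi := (ih n (by omega) ε hε hεK c hc (pd i u) (contDiff_pd i hu) α hα' x).trans
      (mul_le_mul_of_nonneg_left (derivSum_pd_le hu i (x + c x)) (by positivity))
    have hsplit : mpd (α + Pi.single i 1) (fun y => u (y + c y)) x -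
          mpd (α + Pi.single i 1) u (x + c x) - linearPart c u (α + Pi.single i 1) x =
        (mpd α (fun y => pd i u (y + c y)) x - mpd α (pd i u) (x + c x) -
          linearPart c (pd i u) α x) +
        ∑ ρ, binomSum α (fun β γ => mpd (β + Pi.single i 1) (fun y => c y ρ) x *
          (mpd γ (fun y => pd ρ u (y + c y)) x - mpd γ (pd ρ u) (x + c x))) := by
      rw [mpd_add_single_comp_id_add hu hcm hα', mpd_add_single i (by omega) hu,
        linearPart_add_single c hu hα']
      simp only [mul_sub, ← binomSum_sub, sum_sub_distrib]
      ring
    rw [hsplit]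
    calc _ ≤ N * ε ^ 2 * derivSum (m + 1) u (x + c x) +
          d * (2 ^ m * (ε * (M * ε * derivSum (m + 1) u (x + c x)))) := by
          refine (abs_add_le _ _).trans (add_le_add hi (abs_sum_binomSum_le hα' ?_))
          intro ρ β hβ
          have hβm : ∑ j, β j ≤ ∑ j, α j := sum_le_sum fun j _ => hβ j
          have hγ : ∑ j, (α - β) j ≤ m := (sum_sub_le α β).trans hα'
          rw [abs_mul]
          exact mul_le_mul (hc.2 _ (by rw [sum_add_single]; omega) ρ x)
            ((hfirst n (by omega) ε hε hεK c hc (pd ρ u) (contDiff_pd ρ hu) _ hγ x).trans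
              (mul_le_mul_of_nonneg_left (derivSum_pd_le hu ρ (x + c x)) (by positivity)))
            (abs_nonneg _) hε
      _ = _ := by ring

lemma linearPart_eq_sum_midx {n : ℕ} (c : EuclideanSpace ℝ (Fin d) → EuclideanSpace ℝ (Fin d))
    (u : EuclideanSpace ℝ (Fin d) → ℝ) {α : Fin d → ℕ} (hα : ∑ i, α i ≤ n)
    (x : EuclideanSpace ℝ (Fin d)) :
    linearPart c u α x =
      ∑ ρ : Fin d, ∑ β ∈ (midx d n).filter (fun β => β ≠ 0 ∧ ∀ i, β i ≤ α i),
        (∏ i, ((α i).choose (β i) : ℝ)) * mpd β (fun y => c y ρ) x *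
          mpd (fun i => α i - β i) (pd ρ u) (x + c x) := by
  refine sum_congr rfl fun ρ _ => ?_
  have hset : (midx d n).filter (fun β => β ≠ 0 ∧ ∀ i, β i ≤ α i) =
      (Iic α).filter (fun β => β ≠ 0) := by
    ext β
    simp only [mem_filter, mem_midx, mem_Iic, Pi.le_def]
    refine ⟨fun h => ⟨h.2.2, h.2.1⟩, fun h => ⟨?_, h.2, h.1⟩⟩
    exact (sum_le_sum fun i _ => h.1 i).trans hα
  rw [hset, sum_filter, binomSum]
  refine sum_congr rfl fun β _ => ?_
  by_cases hβ : β = 0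
  · simp [hβ]
  · rw [if_neg hβ, if_pos hβ, mul_assoc]
    rfl

end SmallPerturbation

/-- Second-order estimate for derivatives of a composition (Lemma on the form of
`∂^α(u(x+c))`): there is `N = N(n,d,K)` such that
`|∂^α(u ∘ T_c)(x) − (∂^α u)(T_c(x)) − Σ_ρ Σ_{0≠β≤α} binom(α,β) ∂^β c^ρ(x) (∂^{α−β}∂_ρ u)(T_c(x))|
  ≤ N ε² Σ_{1 ≤ |ζ| ≤ n} |(∂^ζ u)(T_c(x))|`. -/
theorem degenerate_SIDE_stmt6 (d n : ℕ) (hd : 1 ≤ d) (hn : 1 ≤ n) (K : ℝ) (hK : 0 < K) :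
    ∃ N : ℝ, ∀ ε : ℝ, 0 < ε → ε ≤ K →
      ∀ c : EuclideanSpace ℝ (Fin d) → EuclideanSpace ℝ (Fin d),
        ContDiff ℝ (n : ℕ∞) c →
        (∀ β : Fin d → ℕ, (∑ i, β i) ≤ n →
          ∀ (ρ : Fin d) (x : EuclideanSpace ℝ (Fin d)), |mpd β (fun y => c y ρ) x| ≤ ε) →
        ∀ u : EuclideanSpace ℝ (Fin d) → ℝ, ContDiff ℝ (n : ℕ∞) u →
          ∀ α : Fin d → ℕ, (∑ i, α i) = n →
            ∀ x : EuclideanSpace ℝ (Fin d),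
              |mpd α (fun y => u (y + c y)) x - mpd α u (x + c x) -
                  ∑ ρ : Fin d, ∑ β ∈ (midx d n).filter (fun β => β ≠ 0 ∧ ∀ i, β i ≤ α i),
                    (∏ i, ((α i).choose (β i) : ℝ)) * mpd β (fun y => c y ρ) x *
                      mpd (fun i => α i - β i) (pd ρ u) (x + c x)| ≤
                N * ε ^ 2 * ∑ ζ ∈ (midx d n).filter (fun ζ => 1 ≤ ∑ i, ζ i),
                  |mpd ζ u (x + c x)| := by
  obtain ⟨N, -, h⟩ := exists_abs_mpd_comp_sub_linearPart_le d n hK.le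
  refine ⟨N, fun ε hε hεK c hc hb u hu α hα x => ?_⟩
  rw [← linearPart_eq_sum_midx c u hα.le x]
  exact h n le_rfl ε hε.le hεK c ⟨hc, hb⟩ u hu α hα.le x
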